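/- The sum, over all pairs (π, a) with π a permutation of {0,…,N−1} and a ∈ {1,…,N−1}, setting π′ = π ∘ (0 ↔ a) (π composed with the transposition exchanging 0 and a), of ‖ψ_π(T) − ψ_{π′}(T)‖², is at most 4·h*·T·N!·√(N−1), where h* = √(∑_{z=0}^{N−1} h(z)² / (N−1)). -/

import Mathlib

/-- The basis state `|z⟩` of `ℂ^N`. -/
noncomputable def ket {N : ℕ} (z : Fin N) : EuclideanSpace ℂ (Fin N) :=
  EuclideanSpace.single z 1

/-- The rank-one operator `|v⟩⟨w| : u ↦ ⟨w,u⟩·v`. -/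
noncomputable def ketbra {N : ℕ} (v w : EuclideanSpace ℂ (Fin N)) :
    EuclideanSpace ℂ (Fin N) →L[ℂ] EuclideanSpace ℂ (Fin N) :=
  (innerSL ℂ w).smulRight v

/-- The scrambled problem Hamiltonian `H_{P,π} = ∑_z h(z)|π(z)⟩⟨π(z)|`. -/
noncomputable def scrambledHam {N : ℕ} (h : Fin N → ℝ) (π : Equiv.Perm (Fin N)) :
    EuclideanSpace ℂ (Fin N) →L[ℂ] EuclideanSpace ℂ (Fin N) :=
  ∑ z, (h z : ℂ) • ketbra (ket (π z)) (ket (π z))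

open scoped InnerProductSpace

theorem ketbra_ket_apply {N : ℕ} (z : Fin N) (v : EuclideanSpace ℂ (Fin N)) :
    ketbra (ket z) (ket z) v = v z • ket z := by
  simp [ketbra, ket, EuclideanSpace.inner_single_left]

theorem inner_scrambledHam_right {N : ℕ} (h : Fin N → ℝ) (π : Equiv.Perm (Fin N))
    (u v : EuclideanSpace ℂ (Fin N)) :
    ⟪u, scrambledHam h π v⟫_ℂ = ∑ z, (h z : ℂ) * (starRingEnd ℂ (u (π z)) * v (π z)) := by
  simp only [scrambledHam, sum_apply, smul_apply,
    inner_sum, inner_smul_right, ketbra_ket_apply]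
  refine Finset.sum_congr rfl fun z _ => ?_
  simp [ket, EuclideanSpace.inner_single_right, mul_comm]

theorem inner_scrambledHam_left {N : ℕ} (h : Fin N → ℝ) (π : Equiv.Perm (Fin N))
    (u v : EuclideanSpace ℂ (Fin N)) :
    ⟪scrambledHam h π u, v⟫_ℂ = ∑ z, (h z : ℂ) * (starRingEnd ℂ (u (π z)) * v (π z)) := by
  rw [← inner_conj_symm, inner_scrambledHam_right]
  simp [mul_comm]

/-- Exchanging the images of `0` and `a` changes only the matrix elements of weight `h a`. -/
theorem inner_scrambledHam_sub_inner_swap {N : ℕ} [NeZero N] {h : Fin N → ℝ} (h0 : h 0 = 0)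
    (π : Equiv.Perm (Fin N)) (a : Fin N) (u v : EuclideanSpace ℂ (Fin N)) :
    ⟪scrambledHam h π u, v⟫_ℂ - ⟪u, scrambledHam h (π * Equiv.swap 0 a) v⟫_ℂ =
      (h a : ℂ) * (starRingEnd ℂ (u (π a)) * v (π a) -
        starRingEnd ℂ (u ((π * Equiv.swap 0 a) a)) * v ((π * Equiv.swap 0 a) a)) := by
  rw [inner_scrambledHam_left, inner_scrambledHam_right, ← Finset.sum_sub_distrib,
    Finset.sum_eq_single a]
  · ring
  · intro z _ hz
    rcases eq_or_ne z 0 with rfl | hz0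
    · simp [h0]
    · simp [Equiv.swap_apply_of_ne_of_ne hz0 hz]
  · simp

theorem norm_inner_scrambledHam_sub_inner_swap_le {N : ℕ} [NeZero N] {h : Fin N → ℝ}
    (h0 : h 0 = 0) (hnn : ∀ z, 0 ≤ h z) (π : Equiv.Perm (Fin N)) (a : Fin N)
    {u v : EuclideanSpace ℂ (Fin N)} (hu : ‖u‖ = 1) (hv : ‖v‖ = 1) :
    ‖⟪scrambledHam h π u, v⟫_ℂ - ⟪u, scrambledHam h (π * Equiv.swap 0 a) v⟫_ℂ‖ ≤
      h a * ‖u (π a)‖ + h a * ‖v ((π * Equiv.swap 0 a) a)‖ := by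
  rw [inner_scrambledHam_sub_inner_swap h0, norm_mul, Complex.norm_real, Real.norm_eq_abs,
    abs_of_nonneg (hnn a), ← mul_add]
  refine mul_le_mul_of_nonneg_left ((norm_sub_le _ _).trans (add_le_add ?_ ?_)) (hnn a)
  · rw [norm_mul, RCLike.norm_conj]
    exact mul_le_of_le_one_right (norm_nonneg _) (hv ▸ PiLp.norm_apply_le v _)
  · rw [norm_mul, RCLike.norm_conj]
    exact mul_le_of_le_one_left (norm_nonneg _) (hu ▸ PiLp.norm_apply_le u _)

theorem inner_schrodinger_deriv {E : Type*} [NormedAddCommGroup E] [InnerProductSpace ℂ E]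
    [CompleteSpace E] {D : E →L[ℂ] E} (hD : IsSelfAdjoint D) (A B : E →L[ℂ] E) (c : ℝ)
    (u v : E) :
    ⟪u, -Complex.I • ((D + (c : ℂ) • B) v)⟫_ℂ + ⟪-Complex.I • ((D + (c : ℂ) • A) u), v⟫_ℂ =
      Complex.I * c * (⟪A u, v⟫_ℂ - ⟪u, B v⟫_ℂ) := by
  have hsymm : ⟪D u, v⟫_ℂ = ⟪u, D v⟫_ℂ := hD.isSymmetric u v
  simp only [add_apply, smul_apply, inner_smul_right,
    inner_smul_left, inner_add_left, inner_add_right, hsymm, map_neg, Complex.conj_I,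
    Complex.conj_ofReal]
  ring

/-- Cauchy–Schwarz for weights against the coordinates of a unit vector, read off along a
permutation. -/
theorem sum_mul_norm_apply_perm_le {N : ℕ} (h : Fin N → ℝ) (π : Equiv.Perm (Fin N))
    {u : EuclideanSpace ℂ (Fin N)} (hu : ‖u‖ = 1) :
    ∑ a, h a * ‖u (π a)‖ ≤ √(∑ z, h z ^ 2) := by
  have hsum : ∑ a, ‖u (π a)‖ ^ 2 = 1 := by
    rw [Equiv.sum_comp π fun z => ‖u z‖ ^ 2, ← EuclideanSpace.norm_sq_eq, hu, one_pow]
  simpa [hsum] using Real.sum_mul_le_sqrt_mul_sqrt Finset.univ h fun a => ‖u (π a)‖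

theorem sum_perm_sum_mul_norm_le {N : ℕ} (h : Fin N → ℝ)
    {u : Equiv.Perm (Fin N) → EuclideanSpace ℂ (Fin N)} (hu : ∀ π, ‖u π‖ = 1) :
    ∑ π : Equiv.Perm (Fin N), ∑ a, h a * ‖u π (π a)‖ ≤ N.factorial * √(∑ z, h z ^ 2) := by
  refine (Finset.sum_le_sum fun π _ => sum_mul_norm_apply_perm_le h π (hu π)).trans_eq ?_
  simp [Fintype.card_perm]

theorem sum_perm_sum_swap_mul_norm_le {N : ℕ} [NeZero N] (h : Fin N → ℝ)
    {u : Equiv.Perm (Fin N) → EuclideanSpace ℂ (Fin N)} (hu : ∀ π, ‖u π‖ = 1) :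
    ∑ π : Equiv.Perm (Fin N), ∑ a,
        h a * ‖u (π * Equiv.swap 0 a) ((π * Equiv.swap 0 a) a)‖ ≤
      N.factorial * √(∑ z, h z ^ 2) := by
  refine le_of_eq_of_le ?_ (sum_perm_sum_mul_norm_le h hu)
  rw [Finset.sum_comm, Finset.sum_comm (s := (Finset.univ : Finset (Equiv.Perm (Fin N))))]
  exact Finset.sum_congr rfl fun a _ =>
    Equiv.sum_comp (Equiv.mulRight (Equiv.swap 0 a)) fun π => h a * ‖u π (π a)‖

/-- **Lemma 1 of Farhi–Goldstone–Gutmann–Nagaj.**  Let `h(0) = 0` and `h(z) > 0` for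
`z ≠ 0`, and for each permutation `π` let `ψ_π` evolve from the `π`-independent unit
vector `ψ₀` under `i·dψ_π/dt = (H_D(t) + c(t)·H_{P,π})·ψ_π(t)`, with `H_D(t)` a
`π`-independent self-adjoint driver and `|c(t)| ≤ 1`.  Then the sum over all pairs
`(π, a)` with `a ≠ 0` and `π′ = π ∘ (0 ↔ a)` of `‖ψ_π(T) − ψ_{π′}(T)‖²` is at most
`4·h*·T·N!·√(N−1)`, where `h* = √(∑_z h(z)²/(N−1))`. -/
theorem scrambled_evolutions_close (N : ℕ) [NeZero N] (hN : 2 ≤ N)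
    (h : Fin N → ℝ) (h0 : h 0 = 0) (hpos : ∀ z : Fin N, z ≠ 0 → 0 < h z)
    (T : ℝ) (hT : 0 < T)
    (HD : ℝ → (EuclideanSpace ℂ (Fin N) →L[ℂ] EuclideanSpace ℂ (Fin N)))
    (hHD : ∀ t, IsSelfAdjoint (HD t))
    (c : ℝ → ℝ) (hc : ∀ t ∈ Set.Icc (0 : ℝ) T, |c t| ≤ 1)
    (ψ0 : EuclideanSpace ℂ (Fin N)) (hψ0 : ‖ψ0‖ = 1)
    (ψ : Equiv.Perm (Fin N) → ℝ → EuclideanSpace ℂ (Fin N))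
    (hψd : ∀ (π : Equiv.Perm (Fin N)), ∀ t ∈ Set.Icc (0 : ℝ) T,
      HasDerivAt (ψ π)
        (-Complex.I • ((HD t + ((c t : ℝ) : ℂ) • scrambledHam h π) (ψ π t))) t)
    (hψi : ∀ π : Equiv.Perm (Fin N), ψ π 0 = ψ0)
    (hψn : ∀ (π : Equiv.Perm (Fin N)), ∀ t ∈ Set.Icc (0 : ℝ) T, ‖ψ π t‖ = 1)
    (hstar : ℝ) (hhstar : hstar = Real.sqrt ((∑ z, h z ^ 2) / ((N : ℝ) - 1))) :
    ∑ π : Equiv.Perm (Fin N), ∑ a ∈ Finset.univ.filter fun a : Fin N => a ≠ 0,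
        ‖ψ π T - ψ (π * Equiv.swap 0 a) T‖ ^ 2
      ≤ 4 * hstar * T * (Nat.factorial N : ℝ) * Real.sqrt ((N : ℝ) - 1) := by
  have hnn : ∀ z, 0 ≤ h z := fun z => by
    rcases eq_or_ne z 0 with rfl | hz
    · exact h0.ge
    · exact (hpos z hz).le
  have hN1 : (0 : ℝ) < (N : ℝ) - 1 := by
    have : (2 : ℝ) ≤ N := by exact_mod_cast hN
    linarith
  have hL : hstar * √((N : ℝ) - 1) = √(∑ z, h z ^ 2) := by
    rw [hhstar, ← Real.sqrt_mul (div_nonneg (Finset.sum_nonneg fun z _ => sq_nonneg _) hN1.le),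
      div_mul_cancel₀ _ hN1.ne']
  set S := Finset.univ.filter fun a : Fin N => a ≠ 0
  let δ : Equiv.Perm (Fin N) → Fin N → ℝ → ℂ := fun π a t =>
    Complex.I * c t * (⟪scrambledHam h π (ψ π t), ψ (π * Equiv.swap 0 a) t⟫_ℂ -
      ⟪ψ π t, scrambledHam h (π * Equiv.swap 0 a) (ψ (π * Equiv.swap 0 a) t)⟫_ℂ)
  have hderiv : ∀ t ∈ Set.Icc (0 : ℝ) T, HasDerivWithinAt
      (fun t => ∑ π, ∑ a ∈ S, ⟪ψ π t, ψ (π * Equiv.swap 0 a) t⟫_ℂ)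
      (∑ π, ∑ a ∈ S, δ π a t) (Set.Icc 0 T) t := by
    intro t ht
    refine (HasDerivAt.fun_sum fun π _ => HasDerivAt.fun_sum fun a _ => ?_).hasDerivWithinAt
    simpa only [δ, inner_schrodinger_deriv (hHD t)] using
      (hψd π t ht).inner ℂ (hψd (π * Equiv.swap 0 a) t ht)
  have hbound : ∀ t ∈ Set.Icc (0 : ℝ) T,
      ‖∑ π, ∑ a ∈ S, δ π a t‖ ≤ 2 * (N.factorial * √(∑ z, h z ^ 2)) := by
    intro t ht
    calc ‖∑ π, ∑ a ∈ S, δ π a t‖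
        ≤ ∑ π, ∑ a ∈ S, ‖δ π a t‖ :=
          (norm_sum_le _ _).trans (Finset.sum_le_sum fun π _ => norm_sum_le _ _)
      _ ≤ ∑ π, ∑ a, ‖δ π a t‖ := Finset.sum_le_sum fun π _ =>
          Finset.sum_le_sum_of_subset_of_nonneg (Finset.subset_univ _) fun _ _ _ => norm_nonneg _
      _ ≤ ∑ π : Equiv.Perm (Fin N), ∑ a, (h a * ‖ψ π t (π a)‖ +
            h a * ‖ψ (π * Equiv.swap 0 a) t ((π * Equiv.swap 0 a) a)‖) := by
          refine Finset.sum_le_sum fun π _ => Finset.sum_le_sum fun a _ => ?_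
          refine le_trans ?_ (norm_inner_scrambledHam_sub_inner_swap_le h0 hnn π a
            (hψn π t ht) (hψn (π * Equiv.swap 0 a) t ht))
          simp only [δ, norm_mul, Complex.norm_I, one_mul, Complex.norm_real, Real.norm_eq_abs]
          exact mul_le_of_le_one_left (norm_nonneg _) (hc t ht)
      _ ≤ 2 * (N.factorial * √(∑ z, h z ^ 2)) := by
          simp only [Finset.sum_add_distrib, two_mul]
          exact add_le_add (sum_perm_sum_mul_norm_le h fun π => hψn π t ht)
            (sum_perm_sum_swap_mul_norm_le h (u := fun π => ψ π t) fun π => hψn π t ht)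
  have hgrowth := norm_image_sub_le_of_norm_deriv_le_segment' hderiv
    (fun t ht => hbound t (Set.Ico_subset_Icc_self ht)) T (Set.right_mem_Icc.2 hT.le)
  have hsq : ∀ (π : Equiv.Perm (Fin N)) (a : Fin N),
      ‖ψ π T - ψ (π * Equiv.swap 0 a) T‖ ^ 2 = -2 *
        (⟪ψ π T, ψ (π * Equiv.swap 0 a) T⟫_ℂ - ⟪ψ π 0, ψ (π * Equiv.swap 0 a) 0⟫_ℂ).re := by
    intro π a
    have hT' : T ∈ Set.Icc (0 : ℝ) T := Set.right_mem_Icc.2 hT.le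
    rw [@norm_sub_sq ℂ, hψn _ T hT', hψn _ T hT', hψi, hψi, inner_self_eq_norm_sq_to_K, hψ0]
    simp
    ring
  simp only [hsq, ← Finset.mul_sum, ← Complex.re_sum, Finset.sum_sub_distrib]
  have hre := (neg_le_abs _).trans ((Complex.abs_re_le_norm _).trans hgrowth)
  calc _ ≤ 4 * (hstar * √((N : ℝ) - 1)) * T * N.factorial := by
        rw [hL]
        linarith
    _ = _ := by ring
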